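/- Let t ∈ 𝔗_∞ with leaves l_1 < l_2 < ⋯ to the left of the infinite spine in increasing lexicographic order, and set s_i = #{v ∈ t : v < l_i}. If j* is an index such that the path in t from l_{j*} to l_{j*+1} contains an edge of the infinite spine, then s_{j*+1} ≥ s_{j*} + 2. Consequently the complement ℕ ∖ {s_i : i ≥ 1} is infinite. -/

import Mathlib

open Set Filter MeasureTheory Topology TopologicalSpace
open scoped ENNReal

namespace AvoidPaper

/-- Instances for the codomain `ℕ∞` (one-point compactification of `ℕ`). -/
instance : SecondCountableTopology ℕ∞ := by
  have h : ({s : Set ℕ∞ | ∃ a, s = Set.Ioi a ∨ s = Set.Iio a}).Countable := by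
    have hsub : {s : Set ℕ∞ | ∃ a, s = Set.Ioi a ∨ s = Set.Iio a}
        ⊆ Set.range (Set.Ioi : ℕ∞ → Set ℕ∞) ∪ Set.range (Set.Iio : ℕ∞ → Set ℕ∞) := by
      rintro s ⟨a, rfl | rfl⟩
      · exact Or.inl ⟨a, rfl⟩
      · exact Or.inr ⟨a, rfl⟩
    exact ((Set.countable_range _).union (Set.countable_range _)).mono hsub
  exact SecondCountableTopology.mk' h

instance : OpensMeasurableSpace ℕ∞ := ⟨le_top⟩

/-! ## Ulam–Harris vertices and rooted ordered trees -/

/-- A vertex of the Ulam–Harris tree: a finite list of natural numbers (children indices),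
ordered lexicographically (so an ancestor precedes its descendants). -/
abbrev Vertex : Type := List ℕ

/-- A (rooted ordered) tree: contains the root, is closed under ancestors, and is
left-closed among siblings. -/
def IsTree (t : Set Vertex) : Prop :=
  ([] : Vertex) ∈ t ∧ (∀ u v : Vertex, u ++ v ∈ t → u ∈ t) ∧
    ∀ (u : Vertex) (i j : ℕ), u ++ [i] ∈ t → j ≤ i → u ++ [j] ∈ t

/-- The set of children indices of `u` in `t`. -/
def children (t : Set Vertex) (u : Vertex) : Set ℕ := {i | u ++ [i] ∈ t}

/-- Locally finite tree. -/
def LocFin (t : Set Vertex) : Prop := ∀ u : Vertex, (children t u).Finite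

/-- Number of children of `u` in `t`. -/
noncomputable def childCount (t : Set Vertex) (u : Vertex) : ℕ := (children t u).ncard

/-- The degree function `d_t(u)`: number of children, and `-1` if `u ∉ t`. -/
noncomputable def deg (t : Set Vertex) (u : Vertex) : ℤ :=
  haveI := Classical.dec (u ∈ t)
  if u ∈ t then (childCount t u : ℤ) else -1

/-- `t^[m]`: restriction of `t` to the vertices of height at most `m`. -/
def trunc (t : Set Vertex) (m : ℕ) : Set Vertex := {u ∈ t | u.length ≤ m}

/-- Local convergence of trees: `d_{t_n}(u) → d_t(u)` for every vertex `u`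
(equivalently, eventual equality, since degrees are integers). -/
def LocalConv (ts : ℕ → Set Vertex) (t : Set Vertex) : Prop :=
  ∀ u : Vertex, ∀ᶠ n in atTop, deg (ts n) u = deg t u

/-- A leaf: a vertex of `t` with no children. -/
def IsLeaf (t : Set Vertex) (v : Vertex) : Prop := v ∈ t ∧ ∀ i : ℕ, v ++ [i] ∉ t

def leafSet (t : Set Vertex) : Set Vertex := {v | IsLeaf t v}

/-- The fringe subtree `t_v` of `t` at `v` (as a subset of `t`). -/
def fringe (t : Set Vertex) (v : Vertex) : Set Vertex := {x ∈ t | v <+: x}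

/-- Number of vertices of `t` at height exactly `k`. -/
noncomputable def levelCount (t : Set Vertex) (k : ℕ) : ℕ := {u ∈ t | u.length = k}.ncard

/-- An infinite spine of `t`: `η 0` is the root and `η (i+1)` is a child of `η i`. -/
def IsSpine (t : Set Vertex) (η : ℕ → Vertex) : Prop :=
  η 0 = [] ∧ (∀ i, η i ∈ t) ∧ ∀ i, ∃ c : ℕ, η (i + 1) = η i ++ [c]

/-- `v` lies strictly to the left of the spine `η`. -/
def LeftOfSpine (t : Set Vertex) (η : ℕ → Vertex) (v : Vertex) : Prop :=
  v ∈ t ∧ (∀ i, η i ≠ v) ∧ ∃ j, v < η j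

/-- `v` lies strictly to the right of the spine `η`. -/
def RightOfSpine (t : Set Vertex) (η : ℕ → Vertex) (v : Vertex) : Prop :=
  v ∈ t ∧ ∀ j, η j < v

/-- `η` is the unique infinite spine of `t`, with infinitely many subtrees attached to
the left and to the right of the spine, infinitely many of the left ones having at
least two vertices. -/
def SpineSpec (t : Set Vertex) (η : ℕ → Vertex) : Prop :=
  IsSpine t η ∧ (∀ η', IsSpine t η' → η' = η) ∧
  {u : Vertex | (∃ k c, u = η k ++ [c]) ∧ LeftOfSpine t η u}.Infinite ∧
  {u : Vertex | (∃ k c, u = η k ++ [c]) ∧ RightOfSpine t η u}.Infinite ∧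
  {u : Vertex | (∃ k c, u = η k ++ [c]) ∧ LeftOfSpine t η u ∧
      2 ≤ (fringe t u).encard}.Infinite

/-- `𝔗_f`: finite trees with at least two vertices. -/
def MemTf (t : Set Vertex) : Prop := IsTree t ∧ t.Finite ∧ 2 ≤ t.encard

/-- `𝔗_∞`. -/
def MemTinf (t : Set Vertex) : Prop :=
  IsTree t ∧ LocFin t ∧ t.Infinite ∧ ∃ η : ℕ → Vertex, SpineSpec t η

/-- The leaves of `t` lying to the left of the spine `η`. -/
def leftLeaves (t : Set Vertex) (η : ℕ → Vertex) : Set Vertex :=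
  {x | IsLeaf t x ∧ LeftOfSpine t η x}

/-- `v` is the enumeration `(v_{t,i})` of (an initial part of) `t` in increasing
lexicographic order: `v i ∈ t` and the vertices of `t` smaller than `v i` are
exactly `v 0, …, v (i-1)`. -/
def IsLexEnum (t : Set Vertex) (v : ℕ → Vertex) : Prop :=
  ∀ i : ℕ, (i : ℕ∞) < t.encard →
    v i ∈ t ∧ {x ∈ t | x < v i} = v '' {j | j < i}

/-- `w` is the enumeration `(w_{t,i})` of (a final part of) `t` in decreasing
lexicographic order, starting from the lexicographically largest vertex. -/
def IsLexCoEnum (t : Set Vertex) (w : ℕ → Vertex) : Prop :=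
  ∀ i : ℕ, (i : ℕ∞) < t.encard →
    w i ∈ t ∧ {x ∈ t | w i < x} = w '' {j | j < i}

/-- `l` enumerates the set `A` in increasing lexicographic order. -/
def IsEnumOf (A : Set Vertex) (l : ℕ → Vertex) : Prop :=
  ∀ i : ℕ, (i : ℕ∞) < A.encard →
    l i ∈ A ∧ {x ∈ A | x < l i} = l '' {j | j < i}

/-- `s_i`: the number of vertices of `t` lexicographically smaller than the `i`-th leaf
(0-indexed: `l 0` is the paper's `l_1`). -/
noncomputable def sVal (t : Set Vertex) (l : ℕ → Vertex) (i : ℕ) : ℕ :=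
  {x ∈ t | x < l i}.ncard

/-- `p_i`: the height of the `i`-th leaf. -/
def pVal (l : ℕ → Vertex) (i : ℕ) : ℕ := (l i).length

/-! ## The maps Φ^σ -/

/-- `Φ^{231}` as an element of `F(ℕ, ℕ*)` (value `i` outside the range of indices). -/
noncomputable def phi231 (t : Set Vertex) (v : ℕ → Vertex) : ℕ → ℕ∞ := fun i =>
  if 1 ≤ i ∧ (i : ℕ∞) < t.encard then
    ((i : ℕ∞) + (fringe t (v i)).encard) - ((v i).length : ℕ∞)
  else (i : ℕ∞)

noncomputable def phi213 (t : Set Vertex) (v : ℕ → Vertex) : ℕ → ℕ∞ := fun i =>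
  if 1 ≤ i ∧ (i : ℕ∞) < t.encard then
    ((t \ fringe t (v i)).encard + ((v i).length : ℕ∞)) - (i : ℕ∞)
  else (i : ℕ∞)

noncomputable def phi312 (t : Set Vertex) (w : ℕ → Vertex) : ℕ → ℕ∞ := fun i =>
  if 1 ≤ i ∧ (i : ℕ∞) < t.encard then
    ((i : ℕ∞) + ((w (i - 1)).length : ℕ∞)) - (fringe t (w (i - 1))).encard
  else (i : ℕ∞)

noncomputable def phi132 (t : Set Vertex) (w : ℕ → Vertex) : ℕ → ℕ∞ := fun i =>
  if 1 ≤ i ∧ (i : ℕ∞) < t.encard then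
    ((t.encard + (fringe t (w (i - 1))).encard) - (i : ℕ∞)) - ((w (i - 1)).length : ℕ∞)
  else (i : ℕ∞)

/-- `B = {s_i - p_i + 1 : i}` (with `i` ranging over indices `< L` of leaves). -/
def Bset (S P : ℕ → ℕ) (L : ℕ∞) : Set ℕ :=
  {b | ∃ i : ℕ, (i : ℕ∞) < L ∧ S i - P i + 1 = b}

/-- `A = {s_i : i}`. -/
def Aset (S : ℕ → ℕ) (L : ℕ∞) : Set ℕ := {a | ∃ i : ℕ, (i : ℕ∞) < L ∧ S i = a}

/-- The number of elements of `C` in `{1, …, j}`. -/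
noncomputable def rankIn (C : Set ℕ) (j : ℕ) : ℕ := (C ∩ Set.Icc 1 j).ncard

/-- The `a`-th smallest positive element of `C`. -/
noncomputable def nthOf (C : Set ℕ) (a : ℕ) : ℕ :=
  sInf {m : ℕ | a ≤ (C ∩ Set.Icc 1 m).ncard}

open Classical in
/-- `Φ^{321}` built from the data `s, p` (and the number `L` of leaves):
`s_i - p_i + 1 ↦ s_i`, extended by the unique increasing bijection between the
complements (and by the identity outside `[1, n]` in the finite case). -/
noncomputable def phi321Fun (S P : ℕ → ℕ) (L : ℕ∞) : ℕ → ℕ∞ := fun j =>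
  if h : j ∈ Bset S P L then (S h.choose : ℕ∞)
  else (nthOf (Aset S L)ᶜ (rankIn (Bset S P L)ᶜ j) : ℕ∞)

/-- `Φ^{123} = |t| + 1 - Φ^{321}` as an element of `F(ℕ, ℕ*)`. -/
noncomputable def phi123Fun (tc : ℕ∞) (f : ℕ → ℕ∞) : ℕ → ℕ∞ := fun j =>
  if 1 ≤ j ∧ (j : ℕ∞) < tc then (tc + 1) - f j else (j : ℕ∞)

/-! ## Patterns and pattern avoidance -/

def p123 : Equiv.Perm (Fin 3) := Equiv.refl _
noncomputable def p321 : Equiv.Perm (Fin 3) := Equiv.ofBijective ![2, 1, 0] (by decide)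
noncomputable def p231 : Equiv.Perm (Fin 3) := Equiv.ofBijective ![1, 2, 0] (by decide)
noncomputable def p213 : Equiv.Perm (Fin 3) := Equiv.ofBijective ![1, 0, 2] (by decide)
noncomputable def p312 : Equiv.Perm (Fin 3) := Equiv.ofBijective ![2, 0, 1] (by decide)
noncomputable def p132 : Equiv.Perm (Fin 3) := Equiv.ofBijective ![0, 2, 1] (by decide)

/-- `π` contains the length-3 pattern `σ`. -/
def ContainsPat {n : ℕ} (π : Equiv.Perm (Fin n)) (σ : Equiv.Perm (Fin 3)) : Prop :=
  ∃ f : Fin 3 → Fin n, StrictMono f ∧ ∀ j k : Fin 3, σ j < σ k ↔ π (f j) < π (f k)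

/-- `π` avoids the length-3 pattern `σ`. -/
def AvoidsPat {n : ℕ} (π : Equiv.Perm (Fin n)) (σ : Equiv.Perm (Fin 3)) : Prop :=
  ¬ ContainsPat π σ

/-- Trees with `n+1` vertices. -/
def TreeN (n : ℕ) : Type := {t : Set Vertex // IsTree t ∧ t.encard = (n : ℕ∞) + 1}

/-- Embedding of a permutation of `[n]` into `F(ℕ, ℕ*)` by `π(k) = k` for `k > n`
(permutations are `1`-indexed: position `k ∈ [1, n]` corresponds to `k - 1 : Fin n`). -/
noncomputable def embedPerm {n : ℕ} (π : Equiv.Perm (Fin n)) : ℕ → ℕ∞ := fun k =>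
  if h : 1 ≤ k ∧ k ≤ n then (((π ⟨k - 1, by omega⟩ : Fin n) : ℕ) + 1 : ℕ) else (k : ℕ∞)

/-- The (finite) set of permutations of `[n]` avoiding `σ`. -/
noncomputable def avoidFinset (σ : Equiv.Perm (Fin 3)) (n : ℕ) : Finset (Equiv.Perm (Fin n)) :=
  Set.Finite.toFinset (Set.toFinite {π : Equiv.Perm (Fin n) | AvoidsPat π σ})

/-- The law of a uniformly random `σ`-avoiding permutation of `[n]`,
as a measure on `F(ℕ, ℕ*)`. -/
noncomputable def uniformAvoidLaw (σ : Equiv.Perm (Fin 3)) (n : ℕ) : Measure (ℕ → ℕ∞) :=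
  ((avoidFinset σ n).card : ℝ≥0∞)⁻¹ • ∑ π ∈ avoidFinset σ n, Measure.dirac (embedPerm π)


open Classical in
/-- `Φ^σ` for an arbitrary pattern `σ ∈ S_3`, given a tree together with its increasing
vertex enumeration `v`, its decreasing vertex enumeration `w`, and the increasing
enumeration `l` of the relevant set `Lset` of leaves. -/
noncomputable def PhiOf (σ : Equiv.Perm (Fin 3)) (t : Set Vertex)
    (v w l : ℕ → Vertex) (Lset : Set Vertex) : ℕ → ℕ∞ :=
  if σ = p231 then phi231 t v
  else if σ = p213 then phi213 t v
  else if σ = p312 then phi312 t w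
  else if σ = p132 then phi132 t w
  else if σ = p321 then phi321Fun (sVal t l) (pVal l) Lset.encard
  else phi123Fun t.encard (phi321Fun (sVal t l) (pVal l) Lset.encard)

open Classical in
noncomputable def canonSpine (t : Set Vertex) : ℕ → Vertex :=
  if h : ∃ η : ℕ → Vertex, IsSpine t η then h.choose else fun _ => []

open Classical in
noncomputable def canonV (t : Set Vertex) : ℕ → Vertex :=
  if h : ∃ v : ℕ → Vertex, IsLexEnum t v then h.choose else fun _ => []

open Classical in
noncomputable def canonW (t : Set Vertex) : ℕ → Vertex :=
  if h : ∃ w : ℕ → Vertex, IsLexCoEnum t w then h.choose else fun _ => []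

open Classical in
noncomputable def canonL (t : Set Vertex) : ℕ → Vertex :=
  if h : ∃ l : ℕ → Vertex, IsEnumOf (leftLeaves t (canonSpine t)) l then h.choose
  else fun _ => []

/-- `Φ^σ_t` for an infinite tree `t ∈ 𝔗_∞`, using the canonical (unique) spine and
enumerations. -/
noncomputable def PhiCanon (σ : Equiv.Perm (Fin 3)) (t : Set Vertex) : ℕ → ℕ∞ :=
  PhiOf σ t (canonV t) (canonW t) (canonL t) (leftLeaves t (canonSpine t))

/-- σ-algebra on the space of trees: all sets are measurable. -/
instance : MeasurableSpace (Set Vertex) := ⊤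

/-- `μ` is the law of a Galton–Watson tree with offspring distribution `ξ`:
a probability measure, supported on trees, giving each finite tree `t` the
probability `∏_{u ∈ t} ξ(d_t(u))`. -/
def IsGW (ξ : ℕ → ℝ≥0∞) (μ : Measure (Set Vertex)) : Prop :=
  IsProbabilityMeasure μ ∧ μ {t | IsTree t} = 1 ∧
    ∀ t : Set Vertex, IsTree t → ∀ ht : t.Finite,
      μ {t} = ∏ u ∈ ht.toFinset, ξ (childCount t u)

/-- `π` is the permutation `Φ^{321}_t` of `[n]` associated to a finite tree `t` with
`n+1` vertices: for every leaf `v` with `s = #{x ∈ t : x < v}` and `p = |v|`, position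
`s - p + 1` is mapped to `s` (in 0-indexed form: position `s - p` to value `s - 1`),
and `π` is increasing on the remaining positions. -/
def Is321Image (n : ℕ) (t : Set Vertex) (π : Equiv.Perm (Fin n)) : Prop :=
  (∀ v : Vertex, IsLeaf t v →
    ∃ hb : {x ∈ t | x < v}.ncard - v.length < n,
      ((π ⟨{x ∈ t | x < v}.ncard - v.length, hb⟩ : Fin n) : ℕ)
        = {x ∈ t | x < v}.ncard - 1) ∧
  ∀ a b : Fin n, a < b →
    (∀ v : Vertex, IsLeaf t v → {x ∈ t | x < v}.ncard - v.length ≠ (a : ℕ)) →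
    (∀ v : Vertex, IsLeaf t v → {x ∈ t | x < v}.ncard - v.length ≠ (b : ℕ)) →
    π a < π b

/-- `π` is the permutation `Φ^{123}_t = (n+1) - Φ^{321}_t` of `[n]`. -/
def Is123Image (n : ℕ) (t : Set Vertex) (π : Equiv.Perm (Fin n)) : Prop :=
  ∃ π' : Equiv.Perm (Fin n), Is321Image n t π' ∧ ∀ i : Fin n, π i = Fin.rev (π' i)


/-! ## Lexicographic order and prefixes -/

theorem append_lt_append_of_not_isPrefix :
    ∀ {u w : Vertex}, u < w → ¬ u <+: w → ∀ y z : Vertex, u ++ y < w ++ z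
  | [], _, _, hp, _, _ => absurd ⟨_, rfl⟩ hp
  | _ :: _, [], h, _, _, _ => absurd h (List.not_lt_nil _)
  | a :: u, b :: w, h, hp, y, z => by
    rw [List.cons_append, List.cons_append, List.cons_lt_cons_iff]
    rcases List.cons_lt_cons_iff.1 h with hab | ⟨rfl, huw⟩
    · exact Or.inl hab
    · exact Or.inr ⟨rfl, append_lt_append_of_not_isPrefix huw
        (fun hq => hp (List.cons_prefix_cons.2 ⟨rfl, hq⟩)) y z⟩

theorem le_of_isPrefix {u w : Vertex} (h : u <+: w) : u ≤ w := by
  obtain ⟨y, rfl⟩ := h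
  refine not_lt.1 ?_
  induction u with
  | nil => exact List.not_lt_nil _
  | cons a u ih =>
    rw [List.cons_append, List.cons_lt_cons_iff]
    simpa using ih

theorem lt_of_lt_of_isPrefix_of_not_isPrefix {a x z : Vertex} (hxz : x < z) (haz : a <+: z)
    (hax : ¬ a <+: x) : x < a := by
  by_contra h
  have hne : a ≠ x := fun h => hax (h ▸ List.prefix_rfl)
  have hlt : a < x := lt_of_le_of_ne (not_lt.1 h) hne
  obtain ⟨p, rfl⟩ := haz
  have := append_lt_append_of_not_isPrefix hlt hax p []
  rw [List.append_nil] at this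
  exact lt_asymm this hxz

theorem isPrefix_of_lt_of_lt {a x y z : Vertex} (hax : a <+: x) (haz : a <+: z)
    (hxy : x < y) (hyz : y < z) : a <+: y := by
  by_contra h
  exact absurd (hxy.trans (lt_of_lt_of_isPrefix_of_not_isPrefix hyz haz h))
    (not_lt.2 (le_of_isPrefix hax))

/-! ## Spines -/

theorem IsSpine.length_eq {t : Set Vertex} {η : ℕ → Vertex} (h : IsSpine t η) (n : ℕ) :
    (η n).length = n := by
  induction n with
  | zero => rw [h.1]; rfl
  | succ n ih =>
    obtain ⟨c, hc⟩ := h.2.2 n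
    simp [hc, ih]

theorem IsSpine.isPrefix {t : Set Vertex} {η : ℕ → Vertex} (h : IsSpine t η) {i j : ℕ}
    (hij : i ≤ j) : η i <+: η j := by
  induction hij with
  | refl => exact List.prefix_rfl
  | step _ ih =>
    obtain ⟨c, hc⟩ := h.2.2 _
    exact ih.trans (hc ▸ List.prefix_append _ _)

theorem IsSpine.lt {t : Set Vertex} {η : ℕ → Vertex} (h : IsSpine t η) {i j : ℕ}
    (hij : i < j) : η i < η j := by
  refine lt_of_le_of_ne (le_of_isPrefix (h.isPrefix hij.le)) fun he => ?_
  have := congrArg List.length he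
  rw [h.length_eq, h.length_eq] at this
  omega

theorem IsSpine.eq_of_isPrefix {t : Set Vertex} {η : ℕ → Vertex} (h : IsSpine t η)
    {u : Vertex} {j : ℕ} (hu : u <+: η j) : η u.length = u := by
  have hle : u.length ≤ j := by simpa [h.length_eq] using hu.length_le
  exact (List.prefix_of_prefix_length_le (h.isPrefix hle) hu
    (h.length_eq _).le).eq_of_length (h.length_eq _)

theorem exists_child_fringe_infinite {t : Set Vertex} (h1 : IsTree t) (h2 : LocFin t)
    {v : Vertex} (hv : (fringe t v).Infinite) : ∃ c, (fringe t (v ++ [c])).Infinite := by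
  by_contra! hcon
  refine hv (((Set.finite_singleton v).union
    ((h2 v).biUnion fun c _ => hcon c)).subset ?_)
  rintro x ⟨hx, y, rfl⟩
  rcases y with _ | ⟨c, y⟩
  · simp
  · have hx' : (v ++ [c]) ++ y ∈ t := by simpa using hx
    exact Or.inr (Set.mem_biUnion (x := c) (h1.2.1 _ _ hx') ⟨hx, y, by simp⟩)

/-- König's lemma: a vertex with infinitely many descendants lies on an infinite spine. -/
theorem exists_isSpine_of_fringe_infinite {t : Set Vertex} (h1 : IsTree t) (h2 : LocFin t)
    {u : Vertex} (hu : (fringe t u).Infinite) : ∃ η, IsSpine t η ∧ η u.length = u := by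
  have step : ∀ v : Vertex, (fringe t v).Infinite ∧ (v <+: u ∨ u <+: v) →
      ∃ c, (fringe t (v ++ [c])).Infinite ∧ (v ++ [c] <+: u ∨ u <+: v ++ [c]) := by
    rintro v ⟨hv, hvu⟩
    by_cases huv : u <+: v
    · obtain ⟨c, hc⟩ := exists_child_fringe_infinite h1 h2 hv
      exact ⟨c, hc, Or.inr (huv.trans (List.prefix_append _ _))⟩
    · obtain ⟨y, rfl⟩ := hvu.resolve_right huv
      rcases y with _ | ⟨c, y⟩
      · simp at huv
      · have hp : v ++ [c] <+: v ++ c :: y := ⟨y, by simp⟩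
        exact ⟨c, hu.mono fun x hx => ⟨hx.1, hp.trans hx.2⟩, Or.inl hp⟩
  choose f hf using step
  let next : {v : Vertex // (fringe t v).Infinite ∧ (v <+: u ∨ u <+: v)} →
      {v : Vertex // (fringe t v).Infinite ∧ (v <+: u ∨ u <+: v)} :=
    fun v => ⟨v.1 ++ [f v.1 v.2], hf v.1 v.2⟩
  let g : ℕ → {v : Vertex // (fringe t v).Infinite ∧ (v <+: u ∨ u <+: v)} := fun n =>
    next^[n] ⟨[], hu.mono fun x hx => ⟨hx.1, ⟨_, rfl⟩⟩, Or.inl ⟨_, rfl⟩⟩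
  have hg : IsSpine t fun n => (g n).1 := by
    refine ⟨rfl, fun i => ?_, fun i => ⟨f (g i).1 (g i).2, ?_⟩⟩
    · obtain ⟨x, hx, y, rfl⟩ := (g i).2.1.nonempty
      exact h1.2.1 _ _ hx
    · change (next^[i + 1] _).1 = (next (next^[i] _)).1
      rw [Function.iterate_succ_apply']
  refine ⟨_, hg, ?_⟩
  have hlen := hg.length_eq u.length
  rcases (g u.length).2.2 with h | h
  · exact h.eq_of_length hlen
  · exact (h.eq_of_length hlen.symm).symm

theorem SpineSpec.eq_of_fringe_infinite {t : Set Vertex} {η : ℕ → Vertex} (h1 : IsTree t)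
    (h2 : LocFin t) (h4 : SpineSpec t η) {u : Vertex} (hu : (fringe t u).Infinite) :
    η u.length = u := by
  obtain ⟨η', h, he⟩ := exists_isSpine_of_fringe_infinite h1 h2 hu
  rw [← h4.2.1 η' h, he]

theorem SpineSpec.finite_lt {t : Set Vertex} {η : ℕ → Vertex} (h1 : IsTree t)
    (h2 : LocFin t) (h4 : SpineSpec t η) (m : ℕ) : {x ∈ t | x < η m}.Finite := by
  induction m with
  | zero => simp [h4.1.1]
  | succ m ih =>
    obtain ⟨c, hc⟩ := h4.1.2.2 m
    have hfr : ∀ d ∈ children t (η m) \ {c}, (fringe t (η m ++ [d])).Finite := by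
      rintro d ⟨-, hd⟩
      by_contra hinf
      have := h4.eq_of_fringe_infinite h1 h2 hinf
      simp only [List.length_append, List.length_singleton, h4.1.length_eq, hc] at this
      simp_all
    refine ((ih.union (Set.finite_singleton (η m))).union
      (((h2 (η m)).subset Set.sdiff_subset).biUnion hfr)).subset ?_
    rintro x ⟨hx, hlt⟩
    by_cases hp : η m <+: x
    · obtain ⟨y, rfl⟩ := hp
      rcases y with _ | ⟨d, y⟩
      · simp
      · have hx' : (η m ++ [d]) ++ y ∈ t := by simpa using hx
        refine Or.inr (Set.mem_biUnion (x := d) ⟨h1.2.1 _ _ hx', ?_⟩ ⟨hx, y, by simp⟩)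
        rintro rfl
        exact absurd hlt (not_lt.2 (le_of_isPrefix ⟨y, by simp [hc]⟩))
    · exact Or.inl (Or.inl ⟨hx, lt_of_lt_of_isPrefix_of_not_isPrefix hlt
        (h4.1.isPrefix m.le_succ) hp⟩)

theorem exists_isLeaf_of_fringe_finite {t : Set Vertex} {u : Vertex} (hu : u ∈ t)
    (hfin : (fringe t u).Finite) : ∃ x, IsLeaf t x ∧ u <+: x := by
  obtain ⟨x, hx, hmax⟩ := hfin.exists_maximalFor List.length _ ⟨u, hu, List.prefix_rfl⟩
  refine ⟨x, ⟨hx.1, fun i hi => ?_⟩, hx.2⟩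
  have := hmax (j := x ++ [i]) ⟨hi, hx.2.trans (List.prefix_append _ _)⟩ (by simp)
  simp at this

theorem LeftOfSpine.of_isPrefix {t : Set Vertex} {η : ℕ → Vertex} (hη : IsSpine t η)
    {u x : Vertex} (hu : LeftOfSpine t η u) (hx : x ∈ t) (hux : u <+: x) :
    LeftOfSpine t η x := by
  have hnot : ∀ j, ¬ u <+: η j := fun j hj => hu.2.1 _ (hη.eq_of_isPrefix hj)
  obtain ⟨j, hj⟩ := hu.2.2
  obtain ⟨y, rfl⟩ := hux
  refine ⟨hx, fun i hi => hnot i (hi ▸ List.prefix_append _ _), j, ?_⟩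
  simpa using append_lt_append_of_not_isPrefix hj (hnot j) y []

theorem SpineSpec.leftLeaves_infinite {t : Set Vertex} {η : ℕ → Vertex} (h1 : IsTree t)
    (h2 : LocFin t) (h4 : SpineSpec t η) : (leftLeaves t η).Infinite := by
  intro hfin
  refine h4.2.2.1 ((hfin.biUnion fun x _ => x.inits.toFinset.finite_toSet).subset ?_)
  rintro u ⟨-, hu⟩
  have hufin : (fringe t u).Finite := Set.not_infinite.1 fun hinf =>
    hu.2.1 _ (h4.eq_of_fringe_infinite h1 h2 hinf)
  obtain ⟨x, hx, hux⟩ := exists_isLeaf_of_fringe_finite hu.1 hufin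
  exact Set.mem_biUnion (x := x) ⟨hx, hu.of_isPrefix h4.1 hx.1 hux⟩ (by simpa using hux)

theorem ncard_lt_strictMono {t : Set Vertex} {x y : Vertex} (hx : x ∈ t) (hxy : x < y)
    (hy : {z ∈ t | z < y}.Finite) : {z ∈ t | z < x}.ncard < {z ∈ t | z < y}.ncard :=
  Set.ncard_lt_ncard ⟨fun _ hz => ⟨hz.1, hz.2.trans hxy⟩,
    fun h => lt_irrefl x (h ⟨hx, hxy⟩).2⟩ hy

/-- Let `t ∈ 𝔗_∞` with spine `η` and left-of-spine leaves `l`.  If the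
path in `t` from `l j*` to `l (j*+1)` contains an edge of the infinite spine (i.e. some
spine vertex `η (k+1)` is an ancestor of exactly one of the two leaves), then
`s_{j*+1} ≥ s_{j*} + 2`.  Consequently `ℕ ∖ {s_i : i ≥ 1}` is infinite. -/
theorem spine_edge_gap (t : Set Vertex) (η : ℕ → Vertex)
    (h1 : IsTree t) (h2 : LocFin t) (h3 : t.Infinite) (h4 : SpineSpec t η)
    (l : ℕ → Vertex) (hl : IsEnumOf (leftLeaves t η) l)
    (jStar : ℕ)
    (hedge : ∃ k : ℕ, Xor' (η (k + 1) <+: l jStar) (η (k + 1) <+: l (jStar + 1))) :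
    sVal t l jStar + 2 ≤ sVal t l (jStar + 1) ∧
    {m : ℕ | ∀ i : ℕ, sVal t l i ≠ m}.Infinite := by
  have hmem : ∀ i, l i ∈ leftLeaves t η ∧
      {x ∈ leftLeaves t η | x < l i} = l '' {j | j < i} := fun i =>
    hl i (by simp [(h4.leftLeaves_infinite h1 h2).encard_eq])
  have hfinη := h4.finite_lt h1 h2
  have hfinl : ∀ i, {x ∈ t | x < l i}.Finite := fun i => by
    obtain ⟨m, hm⟩ := (hmem i).1.2.2.2
    exact (hfinη m).subset fun x hx => ⟨hx.1, hx.2.trans hm⟩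
  constructor
  · have hlt : l jStar < l (jStar + 1) := by
      have : l jStar ∈ l '' {j | j < jStar + 1} := ⟨jStar, Nat.lt_succ_self _, rfl⟩
      rw [← (hmem _).2] at this
      exact this.2
    obtain ⟨k, ⟨hp, hn⟩ | ⟨hp, hn⟩⟩ := hedge
    · obtain ⟨m, hm⟩ := (hmem (jStar + 1)).1.2.2.2
      have hm' : l (jStar + 1) < η (max m (k + 1)) :=
        hm.trans_le (le_of_isPrefix (h4.1.isPrefix (le_max_left _ _)))
      exact absurd (isPrefix_of_lt_of_lt hp (h4.1.isPrefix (le_max_right _ _)) hlt hm') hn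
    · have hlt₁ : l jStar < η (k + 1) := lt_of_lt_of_isPrefix_of_not_isPrefix hlt hp hn
      have hlt₂ : η (k + 1) < l (jStar + 1) :=
        lt_of_le_of_ne (le_of_isPrefix hp) ((hmem _).1.2.2.1 _)
      have hc₁ := ncard_lt_strictMono (hmem jStar).1.1.1 hlt₁ (hfinη _)
      have hc₂ := ncard_lt_strictMono (h4.1.2.1 (k + 1)) hlt₂ (hfinl _)
      unfold sVal
      omega
  · have hmono : StrictMono fun k => {x ∈ t | x < η k}.ncard := fun i j hij =>
      ncard_lt_strictMono (h4.1.2.1 i) (h4.1.lt hij) (hfinη j)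
    refine (Set.infinite_range_of_injective hmono.injective).mono ?_
    rintro _ ⟨k, rfl⟩ i
    rcases lt_or_gt_of_ne ((hmem i).1.2.2.1 k) with h | h
    · exact (ncard_lt_strictMono (h4.1.2.1 k) h (hfinl i)).ne'
    · exact (ncard_lt_strictMono (hmem i).1.1.1 h (hfinη k)).ne

end AvoidPaper
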